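/- arXiv:1011.0555 — 2 statements merged into one kernel-verified Lean document; each statement's English description precedes it below -/
import Mathlib

section
/- Let n ≥ 1 and let α_1,…,α_n be positive integers. Suppose q_1,…,q_n are nonnegative integers satisfying the congruences (L/α_i)·q_i ≡ −1 (mod p_i) for every i. Then L² divides P + L·∑_{i=1}^n q_i·A_i, and the quotient b = (P + L·∑_{i=1}^n q_i·A_i)/L² is a positive integer. (This is the integrality and positivity of the central plumbing weight b in Theorem 3.2.) -/
/-- The lcm `L = lcm(α_1, …, α_n)`. -/
def brieskornL (n : ℕ) (α : Fin n → ℕ) : ℕ :=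
  (Finset.univ : Finset (Fin n)).lcm α

/-- The lcm over the indices different from `i`, `L_i = lcm_{j ≠ i} α_j`
(the lcm of the empty family being `1`). -/
def brieskornLi (n : ℕ) (α : Fin n → ℕ) (i : Fin n) : ℕ :=
  ((Finset.univ : Finset (Fin n)).erase i).lcm α

/-- The product over the indices different from `i`, `A_i = ∏_{j ≠ i} α_j`. -/
def brieskornA (n : ℕ) (α : Fin n → ℕ) (i : Fin n) : ℕ :=
  ∏ j ∈ (Finset.univ : Finset (Fin n)).erase i, α j

/-- The full product `P = ∏ α_j`. -/
def brieskornProd (n : ℕ) (α : Fin n → ℕ) : ℕ :=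
  ∏ j : Fin n, α j

/-- `p_i = L / L_i`. -/
def brieskornP (n : ℕ) (α : Fin n → ℕ) (i : Fin n) : ℕ :=
  brieskornL n α / brieskornLi n α i

/-- `α_i * L` divides the numerator `P + L * ∑ q_j * A_j` as soon as the congruence holds at `i`. -/
theorem mul_brieskornL_dvd (n : ℕ) (α : Fin n → ℕ) (q : Fin n → ℕ) (i : Fin n)
    (hq : ((brieskornL n α / α i : ℕ) : ℤ) * (q i : ℤ) ≡ -1
        [ZMOD ((brieskornP n α i : ℕ) : ℤ)]) :
    brieskornL n α * α i ∣
      brieskornProd n α + brieskornL n α * ∑ j, q j * brieskornA n α j := by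
  have hαL : α i ∣ brieskornL n α := Finset.dvd_lcm (Finset.mem_univ i)
  have hLiL : brieskornLi n α i ∣ brieskornL n α :=
    Finset.lcm_mono (Finset.erase_subset _ _)
  have hLiA : brieskornLi n α i ∣ brieskornA n α i :=
    Finset.lcm_dvd fun j hj => Finset.dvd_prod_of_mem α hj
  have hP : α i * brieskornA n α i = brieskornProd n α :=
    Finset.mul_prod_erase _ α (Finset.mem_univ i)
  have hdvd : brieskornP n α i ∣ brieskornL n α / α i * q i + 1 := by
    have h := hq.symm.dvd
    rw [sub_neg_eq_add] at h
    exact_mod_cast h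
  rw [← Finset.add_sum_erase _ _ (Finset.mem_univ i), mul_add, ← add_assoc]
  refine dvd_add ?_ (mul_dvd_mul_left _ (Finset.dvd_sum fun j hj => ?_))
  · have hfactor : brieskornProd n α + brieskornL n α * (q i * brieskornA n α i) =
        brieskornA n α i * (brieskornL n α / α i * q i + 1) * α i := by
      conv_lhs => rw [← hP, ← Nat.div_mul_cancel hαL]
      ring
    rw [hfactor]
    refine mul_dvd_mul_right ?_ _
    calc brieskornL n α = brieskornLi n α i * brieskornP n α i :=
          (Nat.mul_div_cancel' hLiL).symm
      _ ∣ _ := mul_dvd_mul hLiA hdvd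
  · refine Dvd.dvd.mul_left (Finset.dvd_prod_of_mem α ?_) _
    exact Finset.mem_erase.2 ⟨(Finset.ne_of_mem_erase hj).symm, Finset.mem_univ i⟩

/-- if nonnegative integers `q_i` satisfy
`(L/α_i)·q_i ≡ -1 (mod p_i)` for every `i`, then `L²` divides
`P + L·∑ q_i·A_i`, and the quotient `b` is a positive integer. -/
theorem brieskorn_b_integral_positive (n : ℕ) (hn : 1 ≤ n)
    (α : Fin n → ℕ) (hα : ∀ i, 0 < α i) (q : Fin n → ℕ)
    (hq : ∀ i, ((brieskornL n α / α i : ℕ) : ℤ) * (q i : ℤ) ≡ -1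
        [ZMOD ((brieskornP n α i : ℕ) : ℤ)]) :
    (brieskornL n α) ^ 2 ∣
      brieskornProd n α + brieskornL n α * ∑ i, q i * brieskornA n α i ∧
    0 < (brieskornProd n α + brieskornL n α * ∑ i, q i * brieskornA n α i) /
        (brieskornL n α) ^ 2 := by
  have hdvd := fun i => mul_brieskornL_dvd n α q i (hq i)
  have hpos : 0 < brieskornProd n α + brieskornL n α * ∑ i, q i * brieskornA n α i :=
    Nat.add_pos_left (Finset.prod_pos fun j _ => hα j) _
  have hL : 0 < brieskornL n α :=
    Nat.pos_of_ne_zero fun h => by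
      obtain ⟨j, -, hj⟩ := Finset.lcm_eq_zero_iff.1 h
      exact (hα j).ne' hj
  have hmain : (brieskornL n α) ^ 2 ∣
      brieskornProd n α + brieskornL n α * ∑ i, q i * brieskornA n α i := by
    obtain ⟨k, hk⟩ := dvd_of_mul_right_dvd (hdvd ⟨0, hn⟩)
    rw [hk] at hdvd ⊢
    rw [sq]
    exact mul_dvd_mul_left _
      (Finset.lcm_dvd fun i _ => Nat.dvd_of_mul_dvd_mul_left hL (hdvd i))
  exact ⟨hmain, Nat.div_pos (Nat.le_of_dvd hpos hmain) (pow_pos hL 2)⟩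
end

section
/- Let n ≥ 1 and let α_1,…,α_n be positive integers, and set t_i = A_i/L_i for each i. Then the rational number g = (2 + (n−2)·(P/L) − ∑_{i=1}^n t_i)/2 is a nonnegative integer; equivalently, the integer 2 + (n−2)·(P/L) − ∑_{i=1}^n t_i is even and nonnegative. (This integer quantity 2g is twice the genus of the central vertex in the plumbing diagram of the Brieskorn link Σ(α_1,…,α_n) in Theorem 3.2.) -/
/-- `t_i = A_i / L_i`. -/
def brieskornT (n : ℕ) (α : Fin n → ℕ) (i : Fin n) : ℕ :=
  brieskornA n α i / brieskornLi n α i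

section FinsetLcm

variable {ι : Type*}

/-- The quotient of the product of a finite family by its least common multiple. -/
def prodDivLcm (α : ι → ℕ) (s : Finset ι) : ℕ :=
  (∏ j ∈ s, α j) / s.lcm α

lemma finset_lcm_dvd_prod (α : ι → ℕ) (s : Finset ι) : s.lcm α ∣ ∏ j ∈ s, α j :=
  Finset.lcm_dvd fun _ hb => Finset.dvd_prod_of_mem α hb

lemma prodDivLcm_mul_lcm (α : ι → ℕ) (s : Finset ι) :
    prodDivLcm α s * s.lcm α = ∏ j ∈ s, α j :=
  Nat.div_mul_cancel (finset_lcm_dvd_prod α s)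

lemma finset_lcm_pos {α : ι → ℕ} (hα : ∀ i, 0 < α i) (s : Finset ι) : 0 < s.lcm α :=
  Nat.pos_of_dvd_of_pos (finset_lcm_dvd_prod α s) (Finset.prod_pos fun i _ => hα i)

lemma prodDivLcm_pos {α : ι → ℕ} (hα : ∀ i, 0 < α i) (s : Finset ι) : 0 < prodDivLcm α s := by
  have h := prodDivLcm_mul_lcm α s
  have hP : 0 < ∏ j ∈ s, α j := Finset.prod_pos fun i _ => hα i
  exact Nat.pos_of_mul_pos_right (h ▸ hP)

variable [DecidableEq ι]

lemma prodDivLcm_insert {α : ι → ℕ} (hα : ∀ i, 0 < α i) {a : ι} {s : Finset ι} (ha : a ∉ s) :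
    prodDivLcm α (insert a s) = prodDivLcm α s * Nat.gcd (α a) (s.lcm α) := by
  have hL := finset_lcm_pos hα (insert a s)
  apply Nat.eq_of_mul_eq_mul_right hL
  rw [prodDivLcm_mul_lcm, Finset.prod_insert ha, Finset.lcm_insert, ← prodDivLcm_mul_lcm α s,
    mul_assoc (prodDivLcm α s)]
  change _ = prodDivLcm α s * (Nat.gcd _ _ * Nat.lcm _ _)
  rw [Nat.gcd_mul_lcm]
  ring

lemma prodDivLcm_eq_erase_mul {α : ι → ℕ} (hα : ∀ i, 0 < α i) {i : ι} {s : Finset ι}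
    (hi : i ∈ s) :
    prodDivLcm α s = prodDivLcm α (s.erase i) * Nat.gcd (α i) ((s.erase i).lcm α) := by
  rw [← prodDivLcm_insert hα (Finset.notMem_erase i s), Finset.insert_erase hi]

lemma sum_insert_erase {M : Type*} [AddCommMonoid M] (f : Finset ι → M) {a : ι} {s : Finset ι}
    (ha : a ∉ s) :
    ∑ i ∈ insert a s, f ((insert a s).erase i) = f s + ∑ i ∈ s, f (insert a (s.erase i)) := by
  rw [Finset.sum_insert ha, Finset.erase_insert ha]
  congr 1
  refine Finset.sum_congr rfl fun i hi => ?_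
  rw [Finset.erase_insert_of_ne (by rintro rfl; exact ha hi)]

lemma cast_gcd_zmod_two_of_even {a : ℕ} (ha : Even a) (b : ℕ) :
    ((Nat.gcd a b : ℕ) : ZMod 2) = b := by
  rw [ZMod.natCast_eq_natCast_iff']
  have h : 2 ∣ Nat.gcd a b ↔ 2 ∣ b := by
    rw [Nat.dvd_gcd_iff]
    exact and_iff_right ha.two_dvd
  omega

lemma sum_prod_erase_zmod_two {α : ι → ℕ} (hα : ∀ i, 0 < α i) {s : Finset ι}
    (hs : Even (s.lcm α)) :
    ∑ i ∈ s, ((∏ j ∈ s.erase i, α j : ℕ) : ZMod 2) = prodDivLcm α s := by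
  obtain ⟨i, hi, h2⟩ := (Nat.prime_two.prime.dvd_finsetProd_iff α).1
    (hs.two_dvd.trans (finset_lcm_dvd_prod α s))
  rw [Finset.sum_eq_single_of_mem i hi, prodDivLcm_eq_erase_mul hα hi, Nat.cast_mul,
    cast_gcd_zmod_two_of_even (even_iff_two_dvd.2 h2), ← Nat.cast_mul, prodDivLcm_mul_lcm]
  intro j _ hj
  rw [ZMod.natCast_eq_zero_iff]
  exact h2.trans (Finset.dvd_prod_of_mem α (Finset.mem_erase.2 ⟨hj.symm, hi⟩))

lemma sum_prodDivLcm_erase_zmod_two {α : ι → ℕ} (hα : ∀ i, 0 < α i) (s : Finset ι) :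
    ∑ i ∈ s, (prodDivLcm α (s.erase i) : ZMod 2) = s.card * prodDivLcm α s := by
  induction s using Finset.induction_on with
  | empty => simp
  | insert a s ha ih =>
    rw [sum_insert_erase (fun u => (prodDivLcm α u : ZMod 2)) ha, Finset.card_insert_of_notMem ha,
      prodDivLcm_insert hα ha]
    have hstep : ∀ i ∈ s, (prodDivLcm α (insert a (s.erase i)) : ZMod 2) =
        prodDivLcm α (s.erase i) * (Nat.gcd (α a) ((s.erase i).lcm α) : ℕ) := fun i _ => by
      rw [prodDivLcm_insert hα (fun h => ha (Finset.mem_of_mem_erase h)), Nat.cast_mul]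
    rw [Finset.sum_congr rfl hstep]
    push_cast
    rcases Nat.even_or_odd (Nat.gcd (α a) (s.lcm α)) with hg | hg
    · have hg2 := hg.two_dvd
      have haE : Even (α a) := even_iff_two_dvd.2 (hg2.trans (Nat.gcd_dvd_left _ _))
      have hLE : Even (s.lcm α) := even_iff_two_dvd.2 (hg2.trans (Nat.gcd_dvd_right _ _))
      have hsum : ∀ i ∈ s, (prodDivLcm α (s.erase i) : ZMod 2) *
          (Nat.gcd (α a) ((s.erase i).lcm α) : ℕ) = ((∏ j ∈ s.erase i, α j : ℕ) : ZMod 2) :=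
        fun i _ => by
          rw [cast_gcd_zmod_two_of_even haE, ← Nat.cast_mul, prodDivLcm_mul_lcm]
      rw [Finset.sum_congr rfl hsum, sum_prod_erase_zmod_two hα hLE,
        (ZMod.natCast_eq_zero_iff _ 2).2 hg2, CharTwo.add_self_eq_zero]
      simp
    · have hsum : ∀ i ∈ s, (prodDivLcm α (s.erase i) : ZMod 2) *
          (Nat.gcd (α a) ((s.erase i).lcm α) : ℕ) = prodDivLcm α (s.erase i) := fun i _ => by
        have hodd : Odd (Nat.gcd (α a) ((s.erase i).lcm α)) :=
          hg.of_dvd_nat (Nat.gcd_dvd_gcd_of_dvd_right _ (Finset.lcm_mono (Finset.erase_subset i s)))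
        rw [ZMod.natCast_eq_one_iff_odd.2 hodd, mul_one]
      rw [Finset.sum_congr rfl hsum, ih, ZMod.natCast_eq_one_iff_odd.2 hg]
      ring

lemma sum_gcd_lcm_erase_le {α : ι → ℕ} (hα : ∀ i, 0 < α i) {b : ℕ} (hb : 0 < b) (s : Finset ι)
    (hs : prodDivLcm α s = 1) :
    ∑ i ∈ s, (Nat.gcd b ((s.erase i).lcm α) : ℤ) ≤
      1 + ((s.card : ℤ) - 1) * Nat.gcd b (s.lcm α) := by
  induction s using Finset.induction_on with
  | empty => simp
  | insert a s ha ih =>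
    rw [prodDivLcm_insert hα ha] at hs
    have hT : prodDivLcm α s = 1 := Nat.eq_one_of_mul_eq_one_right hs
    have hcop : Nat.Coprime (α a) (s.lcm α) := Nat.eq_one_of_mul_eq_one_left hs
    have ih := ih hT
    rw [sum_insert_erase (fun u => (Nat.gcd b (u.lcm α) : ℤ)) ha, Finset.card_insert_of_notMem ha]
    have hG : Nat.gcd b ((insert a s).lcm α) = Nat.gcd b (α a) * Nat.gcd b (s.lcm α) := by
      rw [Finset.lcm_insert]
      change Nat.gcd b (Nat.lcm _ _) = _
      rw [hcop.lcm_eq_mul, hcop.gcd_mul]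
    have hle : ∑ i ∈ s, (Nat.gcd b ((insert a (s.erase i)).lcm α) : ℤ) ≤
        Nat.gcd b (α a) * ∑ i ∈ s, (Nat.gcd b ((s.erase i).lcm α) : ℤ) := by
      rw [Finset.mul_sum]
      refine Finset.sum_le_sum fun i _ => ?_
      have hdvd : Nat.gcd b ((insert a (s.erase i)).lcm α) ∣
          Nat.gcd b (α a) * Nat.gcd b ((s.erase i).lcm α) := by
        rw [Finset.lcm_insert]
        exact (Nat.gcd_dvd_gcd_of_dvd_right b (Nat.lcm_dvd_mul _ _)).trans
          (Nat.gcd_mul_right_dvd_mul_gcd b _ _)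
      exact_mod_cast Nat.le_of_dvd
        (Nat.mul_pos (Nat.gcd_pos_of_pos_left _ hb) (Nat.gcd_pos_of_pos_left _ hb)) hdvd
    rw [hG]
    have h1 : (1 : ℤ) ≤ Nat.gcd b (α a) := by exact_mod_cast Nat.gcd_pos_of_pos_left _ hb
    have h2 : (1 : ℤ) ≤ Nat.gcd b (s.lcm α) := by exact_mod_cast Nat.gcd_pos_of_pos_left _ hb
    have h3 := mul_le_mul_of_nonneg_left ih (zero_le_one.trans h1)
    push_cast
    nlinarith [mul_nonneg (sub_nonneg.2 h1) (sub_nonneg.2 h2)]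

lemma sum_prodDivLcm_erase_le {α : ι → ℕ} (hα : ∀ i, 0 < α i) (s : Finset ι) :
    ∑ i ∈ s, (prodDivLcm α (s.erase i) : ℤ) ≤ 2 + ((s.card : ℤ) - 2) * prodDivLcm α s := by
  induction s using Finset.induction_on with
  | empty => simp [prodDivLcm]
  | insert a s ha ih =>
    rw [sum_insert_erase (fun u => (prodDivLcm α u : ℤ)) ha, Finset.card_insert_of_notMem ha,
      prodDivLcm_insert hα ha]
    have hstep : ∀ i ∈ s, (prodDivLcm α (insert a (s.erase i)) : ℤ) =
        prodDivLcm α (s.erase i) * (Nat.gcd (α a) ((s.erase i).lcm α) : ℕ) := fun i _ => by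
      rw [prodDivLcm_insert hα (fun h => ha (Finset.mem_of_mem_erase h)), Nat.cast_mul]
    rw [Finset.sum_congr rfl hstep]
    have hg : (1 : ℤ) ≤ Nat.gcd (α a) (s.lcm α) := by
      exact_mod_cast Nat.gcd_pos_of_pos_left _ (hα a)
    rcases (Nat.succ_le_of_lt (prodDivLcm_pos hα s)).eq_or_lt with hT | hT
    · have hT1 : prodDivLcm α s = 1 := hT.symm
      have hsum : ∀ i ∈ s, (prodDivLcm α (s.erase i) : ℤ) *
          (Nat.gcd (α a) ((s.erase i).lcm α) : ℕ) = (Nat.gcd (α a) ((s.erase i).lcm α) : ℕ) :=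
        fun i hi => by
          rw [prodDivLcm_eq_erase_mul hα hi] at hT1
          rw [Nat.eq_one_of_mul_eq_one_right hT1]
          simp
      rw [Finset.sum_congr rfl hsum, hT1]
      have h := sum_gcd_lcm_erase_le hα (hα a) s hT1
      push_cast
      linarith
    · have hle : ∑ i ∈ s, (prodDivLcm α (s.erase i) : ℤ) *
          (Nat.gcd (α a) ((s.erase i).lcm α) : ℕ) ≤
          (∑ i ∈ s, (prodDivLcm α (s.erase i) : ℤ)) * Nat.gcd (α a) (s.lcm α) := by
        rw [Finset.sum_mul]
        refine Finset.sum_le_sum fun i _ => ?_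
        have hdvd : Nat.gcd (α a) ((s.erase i).lcm α) ∣ Nat.gcd (α a) (s.lcm α) :=
          Nat.gcd_dvd_gcd_of_dvd_right _ (Finset.lcm_mono (Finset.erase_subset i s))
        exact_mod_cast Nat.mul_le_mul_left _
          (Nat.le_of_dvd (Nat.gcd_pos_of_pos_left _ (hα a)) hdvd)
      have h3 := mul_le_mul_of_nonneg_right ih (zero_le_one.trans hg)
      have hT2 : (2 : ℤ) ≤ prodDivLcm α s := by exact_mod_cast hT
      push_cast
      nlinarith [mul_nonneg (sub_nonneg.2 hT2) (sub_nonneg.2 hg)]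

end FinsetLcm

/-- the integer `2 + (n-2)·(P/L) - ∑ t_i` is even and
nonnegative; its half is the genus `g` of the central vertex in the plumbing
diagram of the Brieskorn link `Σ(α_1,…,α_n)`. -/
theorem brieskorn_genus_nonneg_integer (n : ℕ) (hn : 1 ≤ n)
    (α : Fin n → ℕ) (hα : ∀ i, 0 < α i) :
    Even ((2 : ℤ) + ((n : ℤ) - 2) * ((brieskornProd n α / brieskornL n α : ℕ) : ℤ)
        - ∑ i, (brieskornT n α i : ℤ)) ∧
    0 ≤ (2 : ℤ) + ((n : ℤ) - 2) * ((brieskornProd n α / brieskornL n α : ℕ) : ℤ)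
        - ∑ i, (brieskornT n α i : ℤ) := by
  have hcard : (Finset.univ : Finset (Fin n)).card = n := Finset.card_fin n
  change Even ((2 : ℤ) + ((n : ℤ) - 2) * (prodDivLcm α Finset.univ : ℤ)
      - ∑ i, (prodDivLcm α (Finset.univ.erase i) : ℤ)) ∧
    0 ≤ (2 : ℤ) + ((n : ℤ) - 2) * (prodDivLcm α Finset.univ : ℤ)
      - ∑ i, (prodDivLcm α (Finset.univ.erase i) : ℤ)
  constructor
  · have h := sum_prodDivLcm_erase_zmod_two hα Finset.univ
    rw [hcard] at h
    rw [even_iff_two_dvd]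
    apply (ZMod.intCast_zmod_eq_zero_iff_dvd _ 2).1
    push_cast
    rw [h, show (2 : ZMod 2) = 0 from rfl]
    ring
  · have h := sum_prodDivLcm_erase_le hα Finset.univ
    rw [hcard] at h
    linarith
end
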